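/- Let N = (J(N), ψ_N) be a von Neumann algebra with no direct summand of type I₂, equipped with its canonical dynamical correspondence. There is a bijective correspondence between (normal) states on N and time-oriented global sections of the (normal) dilated probabilistic presheaf of N over V(N); in particular, every global section arising from a state of N is automatically time-oriented (with respect to N₁ = N and N₂ = ℂ), since every positive linear functional on N is completely positive and its GNS dilation σ(a) = v*π(a)v is given by a *-representation π. -/

import Mathlib

/-!
Gleason's theorem in presheaf form III (Thm. 6): for a von Neumann algebra
`N = (J(N), ψ_N)` with no type I₂ summand, equipped with its canonical dynamical
correspondence, (normal) states of `N` correspond bijectively to *time-oriented*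
global sections of the (normal) dilated probabilistic presheaf of `N` over `V(N)`.
In particular, the global section arising from the GNS dilation of a state is
automatically time-oriented (with respect to `N₁ = N` and `N₂ = ℂ`).
-/

noncomputable section

open scoped ComplexOrder ComplexInnerProductSpace

namespace VNG

universe u

variable {H : Type u} [NormedAddCommGroup H] [InnerProductSpace ℂ H] [CompleteSpace H]

/-- `p` is an orthogonal projection operator on `H`. -/
def IsProjOp (p : H →L[ℂ] H) : Prop :=
  IsSelfAdjoint p ∧ IsIdempotentElem p

/-- A set of pairwise orthogonal projection operators. -/
def OrthFamily (s : Set (H →L[ℂ] H)) : Prop :=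
  (∀ p ∈ s, IsProjOp p) ∧ ∀ p ∈ s, ∀ q ∈ s, p ≠ q → p * q = 0

/-- `P` is the sum of the family `s` in the strong operator topology. -/
def IsSOTSum (s : Set (H →L[ℂ] H)) (P : H →L[ℂ] H) : Prop :=
  ∀ x : H, HasSum (fun p : s => (p : H →L[ℂ] H) x) (P x)

/-- A finitely additive probability measure on the projection lattice of `S`. -/
def IsFinAddProbMeasure (S : Set (H →L[ℂ] H)) (μ : (H →L[ℂ] H) → ℝ) : Prop :=
  μ 1 = 1 ∧ (∀ p ∈ S, IsProjOp p → 0 ≤ μ p ∧ μ p ≤ 1) ∧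
    ∀ p ∈ S, ∀ q ∈ S, IsProjOp p → IsProjOp q → p * q = 0 → μ (p + q) = μ p + μ q

/-- Complete additivity of a measure on the projections of `S`. -/
def IsCompletelyAdditive (S : Set (H →L[ℂ] H)) (μ : (H →L[ℂ] H) → ℝ) : Prop :=
  ∀ s ⊆ S, OrthFamily s → ∀ P ∈ S, IsSOTSum s P →
    HasSum (fun p : s => μ (p : H →L[ℂ] H)) (μ P)

/-- `σ` is linear on the subset `S` of operators. -/
def IsLinearOn (S : Set (H →L[ℂ] H)) (σ : (H →L[ℂ] H) → ℂ) : Prop :=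
  (∀ a ∈ S, ∀ b ∈ S, σ (a + b) = σ a + σ b) ∧
    ∀ (c : ℂ), ∀ a ∈ S, σ (c • a) = c * σ a

/-- `σ` is positive on `S`. -/
def IsPositiveOn (S : Set (H →L[ℂ] H)) (σ : (H →L[ℂ] H) → ℂ) : Prop :=
  ∀ a ∈ S, 0 ≤ σ (star a * a)

/-- A state on `S`: a normalised positive linear functional. -/
def IsStateOn (S : Set (H →L[ℂ] H)) (σ : (H →L[ℂ] H) → ℂ) : Prop :=
  IsLinearOn S σ ∧ σ 1 = 1 ∧ IsPositiveOn S σ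

/-- Complete additivity of a functional on the projections of `S`. -/
def IsCompletelyAdditiveFunctional (S : Set (H →L[ℂ] H)) (σ : (H →L[ℂ] H) → ℂ) : Prop :=
  ∀ s ⊆ S, OrthFamily s → ∀ P ∈ S, IsSOTSum s P →
    HasSum (fun p : s => σ (p : H →L[ℂ] H)) (σ P)

/-- A normal state on `S`. -/
def IsNormalStateOn (S : Set (H →L[ℂ] H)) (σ : (H →L[ℂ] H) → ℂ) : Prop :=
  IsStateOn S σ ∧ IsCompletelyAdditiveFunctional S σ

/-- `c` is the trace of `ρ`. -/
def HasTrace (ρ : H →L[ℂ] H) (c : ℂ) : Prop :=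
  ∀ (ι : Type u) (b : HilbertBasis ι ℂ H), HasSum (fun i => (⟪b i, ρ (b i)⟫ : ℂ)) c

/-- `ρ` is of trace class. -/
def IsTraceClass (ρ : H →L[ℂ] H) : Prop :=
  ∃ c, HasTrace ρ c

/-- A central projection of the von Neumann algebra `N`. -/
def IsCentralProjection (N : VonNeumannAlgebra H) (z : H →L[ℂ] H) : Prop :=
  z ∈ N ∧ IsProjOp z ∧ ∀ a ∈ N, a * z = z * a

/-- An abelian projection of the von Neumann algebra `N`: `p N p` is commutative. -/
def IsAbelianProjection (N : VonNeumannAlgebra H) (p : H →L[ℂ] H) : Prop :=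
  p ∈ N ∧ IsProjOp p ∧
    ∀ a ∈ N, ∀ b ∈ N, p * a * p * (p * b * p) = p * b * p * (p * a * p)

/-- `N` has no direct summand of type I₂: no nonzero central projection of `N` is the
sum of two Murray-von Neumann equivalent abelian projections. -/
def NoTypeI2Summand (N : VonNeumannAlgebra H) : Prop :=
  ¬ ∃ z p₁ p₂ u : H →L[ℂ] H, IsCentralProjection N z ∧ z ≠ 0 ∧
      IsAbelianProjection N p₁ ∧ IsAbelianProjection N p₂ ∧ z = p₁ + p₂ ∧
      u ∈ N ∧ star u * u = p₁ ∧ u * star u = p₂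

/-- A context of `N`: a commutative von Neumann subalgebra of `N`. -/
def IsContext (N V : VonNeumannAlgebra H) : Prop :=
  (V : Set (H →L[ℂ] H)) ⊆ (N : Set (H →L[ℂ] H)) ∧ ∀ a ∈ V, ∀ b ∈ V, a * b = b * a

/-- A global section of the probabilistic presheaf of `N` over the context category
`V(N)`: a family of finitely additive probability measures, one for each commutative
von Neumann subalgebra of `N`, compatible under restriction. -/
def IsGlobalSection (N : VonNeumannAlgebra H)
    (μ : VonNeumannAlgebra H → (H →L[ℂ] H) → ℝ) : Prop :=
  (∀ V, IsContext N V → IsFinAddProbMeasure (V : Set (H →L[ℂ] H)) (μ V)) ∧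
    ∀ V W, IsContext N V → IsContext N W →
      (V : Set (H →L[ℂ] H)) ⊆ (W : Set (H →L[ℂ] H)) →
      ∀ p ∈ V, IsProjOp p → μ V p = μ W p

/-- A global section of the normal probabilistic presheaf of `N` over `V(N)`:
additionally every measure in the family is completely additive. -/
def IsNormalGlobalSection (N : VonNeumannAlgebra H)
    (μ : VonNeumannAlgebra H → (H →L[ℂ] H) → ℝ) : Prop :=
  IsGlobalSection N μ ∧
    ∀ V, IsContext N V → IsCompletelyAdditive (V : Set (H →L[ℂ] H)) (μ V)

/-- A bundled complex Hilbert space. -/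
structure HilbertSpc : Type (u + 1) where
  carrier : Type u
  [nacg : NormedAddCommGroup carrier]
  [ips : InnerProductSpace ℂ carrier]
  [cs : CompleteSpace carrier]

attribute [instance] HilbertSpc.nacg HilbertSpc.ips HilbertSpc.cs

instance : CoeSort HilbertSpc.{u} (Type u) := ⟨HilbertSpc.carrier⟩

section Embeddings

variable {K : Type u} [NormedAddCommGroup K] [InnerProductSpace ℂ K] [CompleteSpace K]

/-- A finitely additive embedding of the projections of `S` into the projection
lattice of the Hilbert space `K`. -/
def IsFinAddEmbedding (S : Set (H →L[ℂ] H)) (φ : (H →L[ℂ] H) → (K →L[ℂ] K)) : Prop :=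
  (∀ p ∈ S, IsProjOp p → IsProjOp (φ p)) ∧
    Set.InjOn φ {p | p ∈ S ∧ IsProjOp p} ∧
    φ 0 = 0 ∧ (∀ p ∈ S, IsProjOp p → φ (1 - p) = 1 - φ p) ∧
    ∀ p ∈ S, ∀ q ∈ S, IsProjOp p → IsProjOp q → p * q = 0 → φ (p + q) = φ p + φ q

/-- A completely additive embedding of the projections of `S` into the projection
lattice of `K`. -/
def IsCompAddEmbedding (S : Set (H →L[ℂ] H)) (φ : (H →L[ℂ] H) → (K →L[ℂ] K)) : Prop :=
  IsFinAddEmbedding S φ ∧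
    ∀ s ⊆ S, OrthFamily s → ∀ P ∈ S, IsSOTSum s P →
      ∀ x : K, HasSum (fun p : s => φ (p : H →L[ℂ] H) x) (φ P x)

/-- A Jordan *-homomorphism on the subset `S` of operators. -/
def IsJordanStarHomOn (S : Set (H →L[ℂ] H)) (Φ : (H →L[ℂ] H) → (K →L[ℂ] K)) : Prop :=
  (∀ a ∈ S, ∀ b ∈ S, Φ (a + b) = Φ a + Φ b) ∧
    (∀ (c : ℂ), ∀ a ∈ S, Φ (c • a) = c • Φ a) ∧
    (∀ a ∈ S, Φ (star a) = star (Φ a)) ∧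
    ∀ a ∈ S, ∀ b ∈ S, Φ (a * b + b * a) = Φ a * Φ b + Φ b * Φ a

/-- Normality (complete additivity on orthogonal families of projections) of an
operator-valued map on `S`. -/
def IsNormalMapOn (S : Set (H →L[ℂ] H)) (Φ : (H →L[ℂ] H) → (K →L[ℂ] K)) : Prop :=
  ∀ s ⊆ S, OrthFamily s → ∀ P ∈ S, IsSOTSum s P →
    ∀ x : K, HasSum (fun p : s => Φ (p : H →L[ℂ] H) x) (Φ P x)

/-- Time-orientation: `Φ` intertwines the time-reversed canonical dynamical
correspondence `ψ* : a ↦ δ_{-ia}` of the domain algebra with the canonical dynamical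
correspondence `ψ' : a ↦ δ_{ia}` on the codomain, `Φ ∘ ψ* = ψ' ∘ Φ`; equivalently `Φ`
reverses commutators on `S`. -/
def TimeOrientedOn (S : Set (H →L[ℂ] H)) (Φ : (H →L[ℂ] H) → (K →L[ℂ] K)) : Prop :=
  ∀ a ∈ S, ∀ b ∈ S, Φ (a * b - b * a) = Φ b * Φ a - Φ a * Φ b

end Embeddings

/-- A time-oriented global section of the dilated probabilistic presheaf of `N` over
`V(N)`: a compatible family of probability measures `μ_V` admitting a joint dilation
`μ_V p = ⟪v, φ_V p v⟫` by finitely additive embeddings `φ_V : P(V) → P(K)` such that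
the induced Jordan *-homomorphism `Φ : N → B(K)` extending the embeddings preserves
the dynamical correspondences, `Φ ∘ ψ*_N = ψ' ∘ Φ`. -/
def IsTimeOrientedDilatedGS (N : VonNeumannAlgebra H)
    (μ : VonNeumannAlgebra H → (H →L[ℂ] H) → ℝ) : Prop :=
  IsGlobalSection N μ ∧
    ∃ (K : HilbertSpc.{u}) (v : K.carrier)
      (φ : VonNeumannAlgebra H → (H →L[ℂ] H) → (K.carrier →L[ℂ] K.carrier)),
      (∀ V, IsContext N V → IsFinAddEmbedding (V : Set (H →L[ℂ] H)) (φ V)) ∧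
      (∀ V W, IsContext N V → IsContext N W →
        (V : Set (H →L[ℂ] H)) ⊆ (W : Set (H →L[ℂ] H)) →
        ∀ p ∈ V, IsProjOp p → φ V p = φ W p) ∧
      (∀ V, IsContext N V → ∀ p ∈ V, IsProjOp p →
        (μ V p : ℂ) = (⟪v, φ V p v⟫ : ℂ)) ∧
      ∃ Φ : (H →L[ℂ] H) → (K.carrier →L[ℂ] K.carrier),
        IsJordanStarHomOn (N : Set (H →L[ℂ] H)) Φ ∧
        (∀ V, IsContext N V → ∀ p ∈ V, IsProjOp p → Φ p = φ V p) ∧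
        TimeOrientedOn (N : Set (H →L[ℂ] H)) Φ

/-- A time-oriented global section of the normal dilated probabilistic presheaf:
as above, with completely additive measures and embeddings and normal `Φ`. -/
def IsTimeOrientedNormalDilatedGS (N : VonNeumannAlgebra H)
    (μ : VonNeumannAlgebra H → (H →L[ℂ] H) → ℝ) : Prop :=
  IsNormalGlobalSection N μ ∧
    ∃ (K : HilbertSpc.{u}) (v : K.carrier)
      (φ : VonNeumannAlgebra H → (H →L[ℂ] H) → (K.carrier →L[ℂ] K.carrier)),
      (∀ V, IsContext N V → IsCompAddEmbedding (V : Set (H →L[ℂ] H)) (φ V)) ∧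
      (∀ V W, IsContext N V → IsContext N W →
        (V : Set (H →L[ℂ] H)) ⊆ (W : Set (H →L[ℂ] H)) →
        ∀ p ∈ V, IsProjOp p → φ V p = φ W p) ∧
      (∀ V, IsContext N V → ∀ p ∈ V, IsProjOp p →
        (μ V p : ℂ) = (⟪v, φ V p v⟫ : ℂ)) ∧
      ∃ Φ : (H →L[ℂ] H) → (K.carrier →L[ℂ] K.carrier),
        IsJordanStarHomOn (N : Set (H →L[ℂ] H)) Φ ∧
        IsNormalMapOn (N : Set (H →L[ℂ] H)) Φ ∧
        (∀ V, IsContext N V → ∀ p ∈ V, IsProjOp p → Φ p = φ V p) ∧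
        TimeOrientedOn (N : Set (H →L[ℂ] H)) Φ


section Projections

lemma IsProjOp.isStarProjection {p : H →L[ℂ] H} (hp : IsProjOp p) : IsStarProjection p :=
  ⟨hp.2, hp.1⟩

lemma IsProjOp.mul_self {p : H →L[ℂ] H} (hp : IsProjOp p) : p * p = p := hp.2

lemma IsProjOp.star_eq {p : H →L[ℂ] H} (hp : IsProjOp p) : star p = p := hp.1

lemma IsProjOp.nonneg {p : H →L[ℂ] H} (hp : IsProjOp p) : 0 ≤ p :=
  hp.isStarProjection.nonneg

lemma IsProjOp.one_sub {p : H →L[ℂ] H} (hp : IsProjOp p) : IsProjOp (1 - p) :=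
  ⟨hp.isStarProjection.one_sub.2, hp.isStarProjection.one_sub.1⟩

lemma IsProjOp.apply_apply {p : H →L[ℂ] H} (hp : IsProjOp p) (x : H) : p (p x) = p x :=
  congr($(hp.2) x)

lemma IsProjOp.inner_left {p : H →L[ℂ] H} (hp : IsProjOp p) (x y : H) :
    ⟪p x, y⟫ = ⟪x, p y⟫ := by
  rw [← ContinuousLinearMap.adjoint_inner_right, ← ContinuousLinearMap.star_eq_adjoint,
    hp.star_eq]

lemma IsProjOp.inner_apply_self {p : H →L[ℂ] H} (hp : IsProjOp p) (x : H) :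
    ⟪x, p x⟫ = ((‖p x‖ ^ 2 : ℝ) : ℂ) := by
  rw [← hp.apply_apply, ← hp.inner_left, hp.apply_apply, inner_self_eq_norm_sq_to_K]
  norm_cast

lemma IsProjOp.norm_apply_le {p : H →L[ℂ] H} (hp : IsProjOp p) (x : H) : ‖p x‖ ≤ ‖x‖ := by
  have h : ‖p x‖ * ‖p x‖ ≤ ‖x‖ * ‖p x‖ := by
    have h1 := norm_inner_le_norm (𝕜 := ℂ) x (p x)
    rwa [hp.inner_apply_self, Complex.norm_real, Real.norm_of_nonneg (by positivity), sq] at h1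
  rcases (norm_nonneg (p x)).eq_or_lt with h0 | h0
  · rw [← h0]; positivity
  · exact le_of_mul_le_mul_right h h0

lemma IsProjOp.mul_eq_zero_symm {p q : H →L[ℂ] H} (hp : IsProjOp p) (hq : IsProjOp q)
    (h : p * q = 0) : q * p = 0 := by
  simpa [hp.star_eq, hq.star_eq] using congr(star $h)

lemma IsProjOp.mul_eq_symm {p q : H →L[ℂ] H} (hp : IsProjOp p) (hq : IsProjOp q)
    (h : p * q = p) : q * p = p := by
  simpa [hp.star_eq, hq.star_eq] using congr(star $h)

lemma IsProjOp.sub {p q : H →L[ℂ] H} (hp : IsProjOp p) (hq : IsProjOp q)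
    (h : p * q = p) : IsProjOp (q - p) := by
  refine ⟨hq.1.sub hp.1, ?_⟩
  simp [IsIdempotentElem, sub_mul, mul_sub, h, hp.mul_eq_symm hq h, hp.mul_self, hq.mul_self]

lemma IsProjOp.add {p q : H →L[ℂ] H} (hp : IsProjOp p) (hq : IsProjOp q)
    (h : p * q = 0) : IsProjOp (p + q) := by
  refine ⟨hp.1.add hq.1, ?_⟩
  simp [IsIdempotentElem, add_mul, mul_add, h, hp.mul_eq_zero_symm hq h, hp.mul_self, hq.mul_self]

lemma mem_of_commute (N : VonNeumannAlgebra H) {a : H →L[ℂ] H}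
    (h : ∀ y ∈ N.commutant, Commute a y) : a ∈ N := by
  rw [← N.commutant_commutant, VonNeumannAlgebra.mem_commutant_iff]
  exact fun y hy => (h y hy).symm.eq

lemma commute_of_mem (N : VonNeumannAlgebra H) {a y : H →L[ℂ] H} (ha : a ∈ N)
    (hy : y ∈ N.commutant) : Commute a y :=
  VonNeumannAlgebra.mem_commutant_iff.1 hy a ha

lemma smul_mem' (N : VonNeumannAlgebra H) (c : ℂ) {a : H →L[ℂ] H} (ha : a ∈ N) : c • a ∈ N :=
  N.toStarSubalgebra.smul_mem ha c

lemma real_smul_mem (N : VonNeumannAlgebra H) (c : ℝ) {a : H →L[ℂ] H} (ha : a ∈ N) :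
    c • a ∈ N := by
  rw [← Complex.coe_smul]; exact smul_mem' N _ ha

lemma isClosed_vonNeumann (N : VonNeumannAlgebra H) : IsClosed (N : Set (H →L[ℂ] H)) := by
  rw [← N.centralizer_centralizer]
  exact Set.isClosed_centralizer _

lemma posPart_mem (N : VonNeumannAlgebra H) {a : H →L[ℂ] H} (ha : a ∈ N) : a⁺ ∈ N := by
  refine mem_of_commute N fun y hy => ?_
  exact (commute_of_mem N ha hy).cfcₙ_real _

lemma sqrt_mem (N : VonNeumannAlgebra H) {a : H →L[ℂ] H} (ha : a ∈ N) : CFC.sqrt a ∈ N := by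
  refine mem_of_commute N fun y hy => ?_
  exact (commute_of_mem N ha hy).cfcₙ_nnreal _

set_option maxHeartbeats 1000000 in
/-- A positive contraction in a von Neumann algebra admits a projection in the algebra splitting
it at the value `1 / 2`. -/
lemma exists_projection_half (N : VonNeumannAlgebra H) {a : H →L[ℂ] H} (ha : a ∈ N)
    (h0 : 0 ≤ a) (h1 : a ≤ 1) :
    ∃ p ∈ N, IsProjOp p ∧ 0 ≤ (2 : ℝ) • a - p ∧ (2 : ℝ) • a - p ≤ 1 := by
  set b : H →L[ℂ] H := (2 : ℝ) • a - 1 with hb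
  have hsa : IsSelfAdjoint b :=
    (IsSelfAdjoint.of_nonneg (smul_nonneg (zero_le_two : (0 : ℝ) ≤ 2) h0)).sub (.one _)
  have hbN : b ∈ N := sub_mem (real_smul_mem N 2 ha) (one_mem N)
  have hbu : b ≤ 1 := by
    have := smul_le_smul_of_nonneg_left h1 (zero_le_two : (0 : ℝ) ≤ 2)
    rw [hb, sub_le_iff_le_add]
    simpa [two_smul] using this
  have hbl : -1 ≤ b := by
    rw [hb]; simpa using smul_nonneg (zero_le_two : (0 : ℝ) ≤ 2) h0
  have hcN : b⁺ ∈ N := posPart_mem N hbN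
  have hcs : IsSelfAdjoint b⁺ := IsSelfAdjoint.of_nonneg (CFC.posPart_nonneg b)
  have hds : IsSelfAdjoint b⁻ := IsSelfAdjoint.of_nonneg (CFC.negPart_nonneg b)
  set U := (b⁺).ker with hU
  set r : H →L[ℂ] H := U.starProjection with hr
  have hrp : IsStarProjection r := isStarProjection_starProjection
  have hrN : r ∈ N := by
    rw [VonNeumannAlgebra.IsStarProjection.mem_iff hrp]
    intro y hy
    rw [hr, Submodule.range_starProjection, Module.End.mem_invtSubmodule]
    intro x hx
    have hc := congr($((commute_of_mem N hcN hy).eq) x)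
    simp only [mul_apply_eq_comp] at hc
    simp only [hU, LinearMap.mem_ker, Submodule.mem_comap, ContinuousLinearMap.coe_coe] at hx ⊢
    rw [hc, hx, map_zero]
  have hcr : b⁺ * r = 0 := by
    ext x
    exact LinearMap.mem_ker.1 (U.starProjection_apply_mem x)
  have hrc : r * b⁺ = 0 := by
    simpa [hrp.2.star_eq, hcs.star_eq] using congr(star $hcr)
  have hrd : r * b⁻ = b⁻ := by
    ext x
    refine Submodule.starProjection_eq_self_iff.2 (LinearMap.mem_ker.2 ?_)
    exact congr($(CFC.posPart_mul_negPart b) x)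
  have hdr : b⁻ * r = b⁻ := by
    simpa [hrp.2.star_eq, hds.star_eq] using congr(star $hrd)
  have hsplit : b = b⁺ - b⁻ := (CFC.posPart_sub_negPart b hsa).symm
  have hpp : IsStarProjection (1 - r) := hrp.one_sub
  have hd : b⁻ ≤ r := by
    have h := hrp.2.conjugate_le_conjugate hbl
    have e : r * (b⁺ - b⁻) * r = -b⁻ := by
      simp only [mul_sub, hrc, hrd, zero_sub, neg_mul, hdr]
    rw [← hsplit] at e
    rw [e] at h
    simpa [hrp.1.eq] using h
  have hc : b⁺ ≤ 1 - r := by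
    have h := hpp.2.conjugate_le_conjugate hbu
    have e : (1 - r) * (b⁺ - b⁻) * (1 - r) = b⁺ := by
      simp only [mul_sub, sub_mul, hrc, hrd, hdr, hcr, zero_mul, mul_one, one_mul]
      abel
    rw [← hsplit] at e
    rw [e] at h
    simpa [hpp.1.eq] using h
  refine ⟨1 - r, sub_mem (one_mem N) hrN, ⟨hpp.2, hpp.1⟩, ?_, ?_⟩
  · have : (2 : ℝ) • a - (1 - r) = b⁺ + (r - b⁻) := by
      rw [show (2 : ℝ) • a = b + 1 by rw [hb]; abel]
      nth_rw 1 [hsplit]; abel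
    rw [this]
    exact add_nonneg (CFC.posPart_nonneg b) (sub_nonneg.2 hd)
  · have : 1 - ((2 : ℝ) • a - (1 - r)) = b⁻ + ((1 - r) - b⁺) := by
      rw [show (2 : ℝ) • a = b + 1 by rw [hb]; abel]
      nth_rw 1 [hsplit]; abel
    exact sub_nonneg.1 (this.symm ▸ add_nonneg (CFC.negPart_nonneg b) (sub_nonneg.2 hc))

/-- A positive contraction in a von Neumann algebra has a binary expansion with digits in the
projections of the algebra. -/
lemma exists_binary_expansion (N : VonNeumannAlgebra H) {a : H →L[ℂ] H} (ha : a ∈ N)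
    (h0 : 0 ≤ a) (h1 : a ≤ 1) :
    ∃ p : ℕ → H →L[ℂ] H, (∀ n, p n ∈ N ∧ IsProjOp (p n)) ∧
      (∀ n, ((2 : ℝ)⁻¹ ^ (n + 1)) • p n ≤ a) ∧
      HasSum (fun n => ((2 : ℝ)⁻¹ ^ (n + 1)) • p n) a := by
  choose f hfN hfp hf0 hf1 using
    fun a : {a : H →L[ℂ] H // a ∈ N ∧ 0 ≤ a ∧ a ≤ 1} =>
      exists_projection_half N a.2.1 a.2.2.1 a.2.2.2
  let g : {a : H →L[ℂ] H // a ∈ N ∧ 0 ≤ a ∧ a ≤ 1} → {a : H →L[ℂ] H // a ∈ N ∧ 0 ≤ a ∧ a ≤ 1} :=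
    fun a => ⟨(2 : ℝ) • (a : H →L[ℂ] H) - f a,
      sub_mem (real_smul_mem N 2 a.2.1) (hfN a), hf0 a, hf1 a⟩
  let s : ℕ → {a : H →L[ℂ] H // a ∈ N ∧ 0 ≤ a ∧ a ≤ 1} := fun n => g^[n] ⟨a, ha, h0, h1⟩
  have hs : ∀ n, (s (n + 1) : H →L[ℂ] H) = (2 : ℝ) • (s n : H →L[ℂ] H) - f (s n) := by
    intro n
    simp only [s, Function.iterate_succ_apply']
    rfl
  have hsum : ∀ n, a = ∑ k ∈ Finset.range n, ((2 : ℝ)⁻¹ ^ (k + 1)) • f (s k) +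
      ((2 : ℝ)⁻¹ ^ n) • (s n : H →L[ℂ] H) := by
    intro n
    induction n with
    | zero => simp [s]
    | succ n ih =>
      rw [Finset.sum_range_succ, hs, smul_sub, smul_smul,
        show ((2 : ℝ)⁻¹ ^ (n + 1)) * 2 = 2⁻¹ ^ n by rw [pow_succ]; simp]
      nth_rw 1 [ih]; abel
  have hterm : ∀ n, 0 ≤ ((2 : ℝ)⁻¹ ^ (n + 1)) • f (s n) := fun n =>
    smul_nonneg (by positivity) (hfp _).nonneg
  refine ⟨fun n => f (s n), fun n => ⟨hfN _, hfp _⟩, fun n => ?_, ?_⟩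
  · rw [hsum (n + 1), Finset.sum_range_succ]
    have h2 : 0 ≤ ((2 : ℝ)⁻¹ ^ (n + 1)) • (s (n + 1) : H →L[ℂ] H) :=
      smul_nonneg (by positivity) (s (n + 1)).2.2.1
    have h3 := Finset.sum_nonneg fun k (_ : k ∈ Finset.range n) => hterm k
    refine le_add_of_le_of_nonneg ?_ h2
    exact le_add_of_nonneg_left h3
  · have hn : ∀ a : H →L[ℂ] H, 0 ≤ a → a ≤ 1 → ‖a‖ ≤ ‖(1 : H →L[ℂ] H)‖ := fun a h h' =>
      CStarAlgebra.norm_le_norm_of_nonneg_of_le h h'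
    have hgeo : Summable fun n : ℕ => (2 : ℝ)⁻¹ ^ (n + 1) * ‖(1 : H →L[ℂ] H)‖ :=
      (((summable_nat_add_iff 1).2
        (summable_geometric_of_lt_one (by norm_num) (by norm_num : (2 : ℝ)⁻¹ < 1)))).mul_right _
    have hsm : Summable fun n => ((2 : ℝ)⁻¹ ^ (n + 1)) • f (s n) := by
      refine Summable.of_norm_bounded hgeo fun n => ?_
      rw [norm_smul, Real.norm_of_nonneg (by positivity)]
      gcongr
      exact hn _ (hfp _).nonneg (sub_nonneg.1 (hfp _).one_sub.nonneg)
    rw [hsm.hasSum_iff_tendsto_nat, ← sub_zero a]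
    have e : (fun n => ∑ k ∈ Finset.range n, ((2 : ℝ)⁻¹ ^ (k + 1)) • f (s k)) =
        fun n => a - ((2 : ℝ)⁻¹ ^ n) • (s n : H →L[ℂ] H) := by
      funext n
      exact eq_sub_of_add_eq (hsum n).symm
    rw [e]
    refine tendsto_const_nhds.sub ?_
    have hb : Filter.Tendsto (fun n : ℕ => (2 : ℝ)⁻¹ ^ n * ‖(1 : H →L[ℂ] H)‖) Filter.atTop
        (nhds 0) := by
      simpa using (tendsto_pow_atTop_nhds_zero_of_lt_one (by norm_num)
        (by norm_num : (2 : ℝ)⁻¹ < 1)).mul_const ‖(1 : H →L[ℂ] H)‖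
    refine squeeze_zero_norm (fun n => ?_) hb
    rw [norm_smul, Real.norm_of_nonneg (by positivity)]
    gcongr
    exact hn _ (s n).2.2.1 (s n).2.2.2

end Projections

section GNS

/-- The Gelfand-Naimark-Segal representation of a state of a von Neumann algebra. -/
lemma exists_gns (N : VonNeumannAlgebra H) {σ : (H →L[ℂ] H) → ℂ}
    (hσ : IsStateOn (N : Set (H →L[ℂ] H)) σ) :
    ∃ (L : HilbertSpc.{u}) (v : L.carrier)
      (π : N.toStarSubalgebra →⋆ₐ[ℂ] (L.carrier →L[ℂ] L.carrier)),
      (∀ a : N.toStarSubalgebra, σ a = ⟪v, π a v⟫) ∧ (∀ a, ‖π a‖ ≤ ‖(a : H →L[ℂ] H)‖) ∧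
        DenseRange (fun a => π a v) := by
  have : IsClosed (N.toStarSubalgebra : Set (H →L[ℂ] H)) := isClosed_vonNeumann N
  let _ : CStarAlgebra N.toStarSubalgebra := StarSubalgebra.cstarAlgebra _
  let _ := CStarAlgebra.spectralOrder N.toStarSubalgebra
  have := CStarAlgebra.spectralOrderedRing N.toStarSubalgebra
  let f : N.toStarSubalgebra →ₗ[ℂ] ℂ :=
    { toFun := fun a => σ a
      map_add' := fun a b => hσ.1.1 _ a.2 _ b.2
      map_smul' := fun c a => hσ.1.2 c _ a.2 }
  let F : N.toStarSubalgebra →ₚ[ℂ] ℂ := PositiveLinearMap.mk₀ f fun x hx => by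
    obtain ⟨y, rfl⟩ := CStarAlgebra.nonneg_iff_eq_star_mul_self.1 hx
    exact hσ.2.2 _ y.2
  refine ⟨⟨F.GNS⟩, ((F.toPreGNS 1 : F.PreGNS) : F.GNS), F.gnsStarAlgHom, fun a => ?_,
    fun a => ?_, ?_⟩
  · change F a = _
    simp [PositiveLinearMap.preGNS_inner_def]
  · exact NonUnitalStarAlgHom.norm_apply_le F.gnsStarAlgHom a
  · have h : (fun a => F.gnsStarAlgHom a ((F.toPreGNS 1 : F.PreGNS) : F.GNS)) =
        fun a => ((F.toPreGNS a : F.PreGNS) : F.GNS) := by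
      funext a; simp
    change DenseRange (fun a => F.gnsStarAlgHom a ((F.toPreGNS 1 : F.PreGNS) : F.GNS))
    rw [h]
    exact UniformSpace.Completion.denseRange_coe.comp F.toPreGNS.surjective.denseRange
      (UniformSpace.Completion.continuous_coe _)

variable {N : VonNeumannAlgebra H} {σ : (H →L[ℂ] H) → ℂ}

lemma IsStateOn.map_sub (hσ : IsStateOn (N : Set (H →L[ℂ] H)) σ) {a b : H →L[ℂ] H} (ha : a ∈ N)
    (hb : b ∈ N) : σ (a - b) = σ a - σ b := by
  have h := hσ.1.1 (a - b) (sub_mem ha hb) b hb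
  rw [sub_add_cancel] at h
  rw [h, add_sub_cancel_right]

lemma IsStateOn.map_real_smul (hσ : IsStateOn (N : Set (H →L[ℂ] H)) σ) {a : H →L[ℂ] H}
    (ha : a ∈ N) (c : ℝ) : σ (c • a) = c * σ a := by
  rw [← Complex.coe_smul]; exact hσ.1.2 c a ha

lemma IsStateOn.map_sum (hσ : IsStateOn (N : Set (H →L[ℂ] H)) σ) {ι : Type*} (s : Finset ι)
    (f : ι → H →L[ℂ] H) (hf : ∀ i ∈ s, f i ∈ N) : σ (∑ i ∈ s, f i) = ∑ i ∈ s, σ (f i) := by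
  classical
  induction s using Finset.induction_on with
  | empty => simpa using hσ.1.2 0 0 (zero_mem N)
  | insert i s hi ih =>
    rw [Finset.sum_insert hi, Finset.sum_insert hi,
      hσ.1.1 _ (hf i (by simp)) _ (sum_mem fun j hj => hf j (by simp [hj])),
      ih fun j hj => hf j (by simp [hj])]

lemma IsStateOn.norm_le (hσ : IsStateOn (N : Set (H →L[ℂ] H)) σ) :
    ∃ C : ℝ, ∀ a ∈ N, ‖σ a‖ ≤ C * ‖a‖ := by
  obtain ⟨L, v, π, h1, h2, -⟩ := exists_gns N hσ
  refine ⟨‖v‖ * ‖v‖, fun a ha => ?_⟩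
  rw [h1 ⟨a, ha⟩]
  calc _ ≤ ‖v‖ * ‖π ⟨a, ha⟩ v‖ := norm_inner_le_norm _ _
    _ ≤ ‖v‖ * (‖a‖ * ‖v‖) := by
      gcongr
      exact (π ⟨a, ha⟩).le_of_opNorm_le (h2 ⟨a, ha⟩) v
    _ = _ := by ring

lemma IsStateOn.cauchy_schwarz (hσ : IsStateOn (N : Set (H →L[ℂ] H)) σ) {a b : H →L[ℂ] H}
    (ha : a ∈ N) (hb : b ∈ N) :
    ‖σ (star a * b)‖ ^ 2 ≤ (σ (star a * a)).re * (σ (star b * b)).re := by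
  obtain ⟨L, v, π, h1, -, -⟩ := exists_gns N hσ
  have key : ∀ x y : N.toStarSubalgebra, σ (star (x : H →L[ℂ] H) * y) = ⟪π x v, π y v⟫ := by
    intro x y
    have := h1 (star x * y)
    rw [map_mul, map_star, mul_apply_eq_comp, ContinuousLinearMap.star_eq_adjoint,
      ContinuousLinearMap.adjoint_inner_right] at this
    exact this
  have k2 : ∀ x : N.toStarSubalgebra, (σ (star (x : H →L[ℂ] H) * x)).re = ‖π x v‖ ^ 2 := by
    intro x
    rw [key, inner_self_eq_norm_sq_to_K]
    norm_cast
  rw [k2 ⟨a, ha⟩, k2 ⟨b, hb⟩, key ⟨a, ha⟩ ⟨b, hb⟩, ← mul_pow]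
  gcongr
  exact norm_inner_le_norm _ _

lemma IsStateOn.nonneg (hσ : IsStateOn (N : Set (H →L[ℂ] H)) σ) {a : H →L[ℂ] H} (ha : a ∈ N)
    (h0 : 0 ≤ a) : 0 ≤ σ a := by
  have h := hσ.2.2 _ (sqrt_mem N ha)
  rwa [(IsSelfAdjoint.of_nonneg (CFC.sqrt_nonneg a)).star_eq, CFC.sqrt_mul_sqrt_self a h0] at h

lemma IsStateOn.proj_eq_re (hσ : IsStateOn (N : Set (H →L[ℂ] H)) σ) {p : H →L[ℂ] H}
    (hp : p ∈ N) (hpp : IsProjOp p) : ((σ p).re : ℂ) = σ p :=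
  Complex.ext rfl (by simpa using (Complex.nonneg_iff.1 (hσ.nonneg hp hpp.nonneg)).2)

lemma IsStateOn.hasSum (hσ : IsStateOn (N : Set (H →L[ℂ] H)) σ) {f : ℕ → H →L[ℂ] H}
    {a : H →L[ℂ] H} (hf : ∀ n, f n ∈ N) (ha : a ∈ N) (h : HasSum f a) :
    HasSum (fun n => σ (f n)) (σ a) := by
  obtain ⟨C, hC⟩ := hσ.norm_le
  have e : (fun s : Finset ℕ => ∑ i ∈ s, σ (f i)) = fun s => σ (∑ i ∈ s, f i) := by
    funext s; rw [hσ.map_sum s f fun i _ => hf i]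
  rw [HasSum, e, tendsto_iff_norm_sub_tendsto_zero]
  have h2 := (tendsto_iff_norm_sub_tendsto_zero.1 h).const_mul C
  rw [mul_zero] at h2
  refine squeeze_zero (fun _ => norm_nonneg _) (fun s => ?_) h2
  have hs : ∑ i ∈ s, f i ∈ N := sum_mem fun i _ => hf i
  rw [← hσ.map_sub hs ha]
  exact hC _ (sub_mem hs ha)

lemma exists_smul_le_one {a : H →L[ℂ] H} (h0 : 0 ≤ a) :
    ∃ c : ℝ, 0 < c ∧ 0 ≤ c • a ∧ c • a ≤ 1 := by
  refine ⟨(‖a‖ + 1)⁻¹, by positivity, smul_nonneg (by positivity) h0, ?_⟩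
  have h := IsSelfAdjoint.le_algebraMap_norm_self (IsSelfAdjoint.of_nonneg h0)
  have h2 : algebraMap ℝ (H →L[ℂ] H) ‖a‖ ≤ (‖a‖ + 1) • (1 : H →L[ℂ] H) := by
    rw [Algebra.algebraMap_eq_smul_one]
    exact smul_le_smul_of_nonneg_right (by linarith) zero_le_one
  have h3 := smul_le_smul_of_nonneg_left (h.trans h2) (by positivity : 0 ≤ (‖a‖ + 1)⁻¹)
  rwa [smul_smul, inv_mul_cancel₀ (by positivity), one_smul] at h3

/-- States of a von Neumann algebra are determined by their values on projections. -/
lemma IsStateOn.eqOn_of_projections {σ' : (H →L[ℂ] H) → ℂ}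
    (hσ : IsStateOn (N : Set (H →L[ℂ] H)) σ) (hσ' : IsStateOn (N : Set (H →L[ℂ] H)) σ')
    (h : ∀ p ∈ N, IsProjOp p → σ p = σ' p) : Set.EqOn σ σ' (N : Set (H →L[ℂ] H)) := by
  have hpos : ∀ a ∈ N, 0 ≤ a → σ a = σ' a := by
    intro a ha h0
    obtain ⟨c, hc, hc0, hc1⟩ := exists_smul_le_one h0
    have hcN := real_smul_mem N c ha
    obtain ⟨p, hp, -, hs⟩ := exists_binary_expansion N hcN hc0 hc1
    have hpN : ∀ n, ((2 : ℝ)⁻¹ ^ (n + 1)) • p n ∈ N := fun n => real_smul_mem N _ (hp n).1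
    have h1 := hσ.hasSum hpN hcN hs
    have h2 := hσ'.hasSum hpN hcN hs
    have e : (fun n => σ (((2 : ℝ)⁻¹ ^ (n + 1)) • p n)) =
        fun n => σ' (((2 : ℝ)⁻¹ ^ (n + 1)) • p n) := by
      funext n
      rw [hσ.map_real_smul (hp n).1, hσ'.map_real_smul (hp n).1, h _ (hp n).1 (hp n).2]
    rw [e] at h1
    have h3 := h1.unique h2
    rw [hσ.map_real_smul ha, hσ'.map_real_smul ha] at h3
    exact mul_left_cancel₀ (by exact_mod_cast hc.ne') h3
  have hsa : ∀ a ∈ N, IsSelfAdjoint a → σ a = σ' a := by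
    intro a ha hs
    have hn : a⁻ ∈ N := by rw [← CFC.posPart_neg]; exact posPart_mem N (neg_mem ha)
    rw [← CFC.posPart_sub_negPart a hs, hσ.map_sub (posPart_mem N ha) hn,
      hσ'.map_sub (posPart_mem N ha) hn, hpos _ (posPart_mem N ha) (CFC.posPart_nonneg a),
      hpos _ hn (CFC.negPart_nonneg a)]
  intro a ha
  have hst : star a ∈ N := star_mem ha
  have hr : (a + star a) ∈ N := add_mem ha hst
  have hi : Complex.I • (a - star a) ∈ N := smul_mem' N _ (sub_mem ha hst)
  have e : a = (2⁻¹ : ℂ) • (a + star a) + (-(Complex.I / 2)) • (Complex.I • (a - star a)) := by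
    rw [smul_smul, show -(Complex.I / 2) * Complex.I = 2⁻¹ by
      rw [neg_mul, div_mul_eq_mul_div, Complex.I_mul_I]; norm_num]
    rw [← smul_add]
    rw [show a + star a + (a - star a) = (2 : ℂ) • a by rw [two_smul]; abel, smul_smul]
    norm_num
  have k1 := hsa _ hr (by simp [IsSelfAdjoint, add_comm])
  have k2 := hsa _ hi (by simp [IsSelfAdjoint, ← smul_neg])
  rw [e, hσ.1.1 _ (smul_mem' N _ hr) _ (smul_mem' N _ hi),
    hσ'.1.1 _ (smul_mem' N _ hr) _ (smul_mem' N _ hi), hσ.1.2 _ _ hr, hσ.1.2 _ _ hi,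
    hσ'.1.2 _ _ hr, hσ'.1.2 _ _ hi, k1, k2]

/-- The von Neumann algebra generated by a projection. -/
def projectionContext (p : H →L[ℂ] H) : VonNeumannAlgebra H where
  toStarSubalgebra := StarSubalgebra.centralizer ℂ
    (Set.centralizer {p} ∩ star (Set.centralizer {p}))
  centralizer_centralizer' := by
    change Set.centralizer (Set.centralizer ((StarSubalgebra.centralizer ℂ
      (Set.centralizer {p} ∩ star (Set.centralizer {p})) : StarSubalgebra ℂ (H →L[ℂ] H)) :
        Set (H →L[ℂ] H))) = ((StarSubalgebra.centralizer ℂ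
      (Set.centralizer {p} ∩ star (Set.centralizer {p})) : StarSubalgebra ℂ (H →L[ℂ] H)) :
        Set (H →L[ℂ] H))
    simp

lemma mem_projectionContext (p : H →L[ℂ] H) : p ∈ projectionContext p := by
  change p ∈ StarSubalgebra.centralizer ℂ _
  rw [StarSubalgebra.mem_centralizer_iff]
  intro g hg
  have h1 := hg.1 p rfl
  have h2 := hg.2 p rfl
  exact ⟨h1.symm, h2.symm⟩

lemma commute_of_mem_projectionContext {p a y : H →L[ℂ] H} (hp : IsSelfAdjoint p)
    (ha : a ∈ projectionContext p) (hy : Commute p y) : y * a = a * y := by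
  change a ∈ StarSubalgebra.centralizer ℂ _ at ha
  rw [StarSubalgebra.mem_centralizer_iff] at ha
  refine (ha y ⟨?_, ?_⟩).1
  · rintro _ rfl; exact hy.eq
  · rintro _ rfl
    simpa [hp.star_eq] using congr(star $(hy.symm.eq))

lemma isContext_projectionContext {p : H →L[ℂ] H} (hp : p ∈ N) (hpp : IsProjOp p) :
    IsContext N (projectionContext p) := by
  refine ⟨fun a ha => mem_of_commute N fun y hy => ?_, fun a ha b hb => ?_⟩
  · exact (commute_of_mem_projectionContext hpp.1 ha (commute_of_mem N hp hy)).symm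
  · refine commute_of_mem_projectionContext hpp.1 hb ?_
    exact (commute_of_mem_projectionContext hpp.1 ha (Commute.refl p))

end GNS

section OrthogonalSums

lemma OrthFamily.mul_eq_ite {s : Set (H →L[ℂ] H)} (hs : OrthFamily s) [DecidableEq s] (p q : s) :
    (p : H →L[ℂ] H) * q = if q = p then (p : H →L[ℂ] H) else 0 := by
  split_ifs with h
  · rw [h, (hs.1 p p.2).mul_self]
  · exact hs.2 _ p.2 _ q.2 fun h' => h (Subtype.ext h'.symm)

lemma OrthFamily.isProjOp_sum {s : Set (H →L[ℂ] H)} (hs : OrthFamily s) (F : Finset s) :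
    IsProjOp (∑ p ∈ F, (p : H →L[ℂ] H)) := by
  classical
  induction F using Finset.induction_on with
  | empty => exact ⟨by simp, by simp [IsIdempotentElem]⟩
  | insert p F hp ih =>
    rw [Finset.sum_insert hp]
    refine (hs.1 p p.2).add ih ?_
    rw [Finset.mul_sum]
    refine Finset.sum_eq_zero fun q hq => ?_
    rw [hs.mul_eq_ite, if_neg]
    rintro rfl
    exact hp hq

lemma IsSOTSum.mul_eq {s : Set (H →L[ℂ] H)} {P : H →L[ℂ] H} (hs : OrthFamily s)
    (hP : IsSOTSum s P) {p : H →L[ℂ] H} (hp : p ∈ s) : p * P = p := by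
  classical
  ext x
  have h1 := p.hasSum (hP x)
  have h2 := hasSum_single (f := fun q : s => p ((q : H →L[ℂ] H) x)) ⟨p, hp⟩ fun q hq => by
    have := congr($(hs.mul_eq_ite ⟨p, hp⟩ q) x)
    rwa [if_neg hq] at this
  exact (h1.unique h2).trans ((hs.1 p hp).apply_apply x)

lemma IsSOTSum.isProjOp {s : Set (H →L[ℂ] H)} {P : H →L[ℂ] H} (hs : OrthFamily s)
    (hP : IsSOTSum s P) : IsProjOp P := by
  constructor
  · rw [ContinuousLinearMap.isSelfAdjoint_iff_isSymmetric]
    intro x y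
    have h1 := (innerSL ℂ x).hasSum (hP y)
    have h2 := (innerSL ℂ y).hasSum (hP x)
    have h3 := h2.star
    simp only [innerSL_apply_apply] at h1 h3
    have e : (fun p : s => star (⟪y, (p : H →L[ℂ] H) x⟫ : ℂ)) =
        fun p : s => ⟪x, (p : H →L[ℂ] H) y⟫ := by
      funext p
      rw [← (hs.1 p p.2).inner_left]
      exact inner_conj_symm _ _
    rw [e] at h3
    have h4 := h3.unique h1
    change (⟪P x, y⟫ : ℂ) = ⟪x, P y⟫
    rw [← h4]
    exact (inner_conj_symm _ _).symm
  · ext x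
    refine (hP (P x)).unique ?_
    convert hP x using 2 with p
    exact congr($(hP.mul_eq hs p.2) x)

lemma OrthFamily.sum_norm_sq {s : Set (H →L[ℂ] H)} (hs : OrthFamily s) (F : Finset s) (x : H) :
    ∑ p ∈ F, ‖(p : H →L[ℂ] H) x‖ ^ 2 = ‖∑ p ∈ F, (p : H →L[ℂ] H) x‖ ^ 2 := by
  have h := (hs.isProjOp_sum F).inner_apply_self x
  rw [sum_apply, inner_sum] at h
  simp_rw [fun p : s => (hs.1 p p.2).inner_apply_self x] at h
  exact_mod_cast h

lemma OrthFamily.norm_sum_le {s : Set (H →L[ℂ] H)} (hs : OrthFamily s) (F : Finset s) (x : H) :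
    ‖∑ p ∈ F, (p : H →L[ℂ] H) x‖ ≤ ‖x‖ := by
  simpa using (hs.isProjOp_sum F).norm_apply_le x

lemma OrthFamily.summable {s : Set (H →L[ℂ] H)} (hs : OrthFamily s) (x : H) :
    Summable fun p : s => (p : H →L[ℂ] H) x := by
  have h : Summable fun p : s => ‖(p : H →L[ℂ] H) x‖ ^ 2 := by
    refine summable_of_sum_le (c := ‖x‖ ^ 2) (fun _ => by positivity) fun F => ?_
    rw [hs.sum_norm_sq]
    gcongr
    exact hs.norm_sum_le F x
  rw [summable_iff_vanishing_norm] at h ⊢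
  intro ε hε
  obtain ⟨F, hF⟩ := h (ε ^ 2) (by positivity)
  refine ⟨F, fun t ht => ?_⟩
  have := hF t ht
  rw [hs.sum_norm_sq, Real.norm_of_nonneg (by positivity)] at this
  exact lt_of_pow_lt_pow_left₀ 2 hε.le this

/-- The strong sum of an orthogonal family of projections. -/
def orthSum {s : Set (H →L[ℂ] H)} (hs : OrthFamily s) : H →L[ℂ] H :=
  LinearMap.mkContinuous
    { toFun := fun x => ∑' p : s, (p : H →L[ℂ] H) x
      map_add' := fun x y => by
        simp only [map_add]
        exact (hs.summable x).tsum_add (hs.summable y)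
      map_smul' := fun c x => by
        simp only [map_smul, RingHom.id_apply]
        exact (hs.summable x).tsum_const_smul c } 1 fun x => by
    rw [one_mul]
    exact le_of_tendsto (hs.summable x).hasSum.norm
      (Filter.Eventually.of_forall fun F => hs.norm_sum_le F x)

lemma isSOTSum_orthSum {s : Set (H →L[ℂ] H)} (hs : OrthFamily s) : IsSOTSum s (orthSum hs) :=
  fun x => (hs.summable x).hasSum

lemma orthSum_mem (N : VonNeumannAlgebra H) {s : Set (H →L[ℂ] H)} (hs : OrthFamily s)
    (hsN : s ⊆ (N : Set (H →L[ℂ] H))) : orthSum hs ∈ N := by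
  refine mem_of_commute N fun y hy => ?_
  ext x
  have h := y.hasSum (isSOTSum_orthSum hs x)
  have e : (fun p : s => y ((p : H →L[ℂ] H) x)) = fun p : s => (p : H →L[ℂ] H) (y x) :=
    funext fun p => congr($((commute_of_mem N (hsN p.2) hy).eq.symm) x)
  rw [e] at h
  exact (isSOTSum_orthSum hs (y x)).unique h

/-- A maximal orthogonal family of subprojections of `P` with a given property exhausts `P` up
to a projection none of whose nonzero subprojections has the property. -/
lemma exists_maximal_orthFamily (N : VonNeumannAlgebra H) (R : (H →L[ℂ] H) → Prop)
    {P : H →L[ℂ] H} (hP : IsProjOp P) :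
    ∃ M ⊆ (N : Set (H →L[ℂ] H)), OrthFamily M ∧ (∀ p ∈ M, R p) ∧
      ∃ Q ∈ N, IsSOTSum M Q ∧ Q * P = Q ∧
        ∀ g ∈ N, IsProjOp g → g ≠ 0 → g * (P - Q) = g → ¬ R g := by
  obtain ⟨M, hM, hmax⟩ := zorn_subset
    {M : Set (H →L[ℂ] H) | M ⊆ (N : Set (H →L[ℂ] H)) ∧ OrthFamily M ∧ ∀ p ∈ M, R p ∧ p * P = p}
    (by
      intro c hc hchain
      refine ⟨⋃₀ c, ⟨Set.sUnion_subset fun t ht => (hc ht).1, ⟨?_, ?_⟩, ?_⟩,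
        fun t ht => Set.subset_sUnion_of_mem ht⟩
      · rintro p ⟨t, ht, hp⟩
        exact (hc ht).2.1.1 p hp
      · rintro p ⟨t, ht, hp⟩ q ⟨t', ht', hq⟩ hpq
        rcases hchain.total ht ht' with h | h
        · exact (hc ht').2.1.2 p (h hp) q hq hpq
        · exact (hc ht).2.1.2 p hp q (h hq) hpq
      · rintro p ⟨t, ht, hp⟩
        exact (hc ht).2.2 p hp)
  obtain ⟨hMN, hMo, hMR⟩ := hM
  have hQ := isSOTSum_orthSum hMo
  refine ⟨M, hMN, hMo, fun p hp => (hMR p hp).1, orthSum hMo, orthSum_mem N hMo hMN, hQ, ?_, ?_⟩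
  · ext x
    refine (hQ (P x)).unique ?_
    convert hQ x using 2 with p
    exact congr($((hMR p p.2).2) x)
  · intro g hgN hg hg0 hgP hgR
    have hQP : orthSum hMo * P = orthSum hMo := by
      ext x
      refine (hQ (P x)).unique ?_
      convert hQ x using 2 with p
      exact congr($((hMR p p.2).2) x)
    have hgp : ∀ p ∈ M, g * p = 0 := by
      intro p hp
      have hpp := hMo.1 p hp
      rw [← hgP, mul_assoc, sub_mul, hpp.mul_eq_symm hP (hMR p hp).2,
        hpp.mul_eq_symm (hQ.isProjOp hMo) (hQ.mul_eq hMo hp), sub_self, mul_zero]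
    have hmem : insert g M ⊆ M := hmax ⟨?_, ⟨?_, ?_⟩, ?_⟩ (Set.subset_insert _ _)
    · have := hgp g (hmem (Set.mem_insert _ _))
      rw [hg.mul_self] at this
      exact hg0 this
    · exact Set.insert_subset hgN hMN
    · rintro p (rfl | hp)
      · exact hg
      · exact hMo.1 p hp
    · rintro p (rfl | hp) q (rfl | hq) hpq
      · exact absurd rfl hpq
      · exact hgp q hq
      · exact hg.mul_eq_zero_symm (hMo.1 p hp) (hgp p hp)
      · exact hMo.2 p hp q hq hpq
    · rintro p (rfl | hp)
      · refine ⟨hgR, ?_⟩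
        have hPP : (P - orthSum hMo) * P = P - orthSum hMo := by
          rw [sub_mul, hP.mul_self, hQP]
        rw [← hgP, mul_assoc, hPP]
      · exact hMR p hp

end OrthogonalSums

section NormalStates

variable {N : VonNeumannAlgebra H} {σ : (H →L[ℂ] H) → ℂ}

/-- `e` supports `σ` in such a way that `σ` is dominated by a vector functional there. -/
def IsVectorDominated (N : VonNeumannAlgebra H) (σ : (H →L[ℂ] H) → ℂ) (e : H →L[ℂ] H) : Prop :=
  ∃ ξ : H, ∀ x ∈ N, (σ (star (x * e) * (x * e))).re ≤ ‖x ξ‖ ^ 2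

lemma IsNormalStateOn.exists_isVectorDominated
    (hσ : IsNormalStateOn (N : Set (H →L[ℂ] H)) σ) {P : H →L[ℂ] H} (hPN : P ∈ N)
    (hP : IsProjOp P) (hP0 : P ≠ 0) :
    ∃ e ∈ N, IsProjOp e ∧ e ≠ 0 ∧ e * P = e ∧ IsVectorDominated N σ e := by
  obtain ⟨x₀, hx₀⟩ : ∃ x, P x ≠ 0 := by
    by_contra! h
    exact hP0 (ContinuousLinearMap.ext h)
  have hσP : 0 ≤ (σ P).re := (Complex.nonneg_iff.1 (hσ.1.nonneg hPN hP.nonneg)).1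
  obtain ⟨ξ, hξ⟩ : ∃ ξ, (σ P).re < ‖P ξ‖ ^ 2 := by
    refine ⟨(((σ P).re + 1) / ‖P x₀‖ : ℝ) • x₀, ?_⟩
    have : 0 < ‖P x₀‖ := norm_pos_iff.2 hx₀
    have hsm : P ((((σ P).re + 1) / ‖P x₀‖ : ℝ) • x₀) = (((σ P).re + 1) / ‖P x₀‖ : ℝ) • P x₀ := by
      rw [← Complex.coe_smul, ← Complex.coe_smul, map_smul]
    rw [hsm, norm_smul, Real.norm_of_nonneg (by positivity), div_mul_cancel₀ _ this.ne']
    nlinarith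
  obtain ⟨M, hMN, hMo, hMR, Q, hQN, hQ, hQP, hmax⟩ :=
    exists_maximal_orthFamily N (fun f => ‖f ξ‖ ^ 2 ≤ (σ f).re) hP
  have hQp := hQ.isProjOp hMo
  have hQσ : ‖Q ξ‖ ^ 2 ≤ (σ Q).re := by
    have h1 := Complex.hasSum_re (hσ.2 M hMN hMo Q hQN hQ)
    have h2 := Complex.hasSum_re ((innerSL ℂ ξ).hasSum (hQ ξ))
    simp only [innerSL_apply_apply, hQp.inner_apply_self, Complex.ofReal_re] at h2
    refine hasSum_le (fun p => ?_) h2 h1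
    simp only [(hMo.1 p p.2).inner_apply_self, Complex.ofReal_re]
    exact hMR p p.2
  have he := hQp.sub hP hQP
  have heN : P - Q ∈ N := sub_mem hPN hQN
  refine ⟨P - Q, heN, he, fun h => ?_, ?_, (P - Q) ξ, ?_⟩
  · rw [sub_eq_zero.1 h] at hξ
    exact hξ.not_ge hQσ
  · rw [sub_mul, hP.mul_self, hQP]
  have hpos : ∀ a ∈ N, 0 ≤ a → a * (P - Q) = a → (σ a).re ≤ (⟪ξ, a ξ⟫ : ℂ).re := by
    intro a ha h0 hae
    obtain ⟨c, hc, hc0, hc1⟩ := exists_smul_le_one h0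
    have hcN := real_smul_mem N c ha
    obtain ⟨p, hp, hle, hs⟩ := exists_binary_expansion N hcN hc0 hc1
    have hpe : ∀ n, p n * (P - Q) = p n := by
      intro n
      have hz : p n * (1 - (P - Q)) = 0 := by
        ext x
        have h1 := (ContinuousLinearMap.le_def _ _).1 (hle n)
        have h3 : (c • a) ((1 - (P - Q)) x) = 0 := by
          have : (c • a) * (1 - (P - Q)) = 0 := by
            rw [mul_sub, mul_one, smul_mul_assoc, hae, sub_self]
          exact congr($this x)
        change p n ((1 - (P - Q)) x) = 0
        generalize (1 - (P - Q)) x = z at h3 ⊢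
        have h2 := h1.re_inner_nonneg_right z
        rw [sub_apply, h3, zero_sub, inner_neg_right,
          smul_apply, ← Complex.coe_smul, inner_smul_right,
          (hp n).2.inner_apply_self, ← Complex.ofReal_mul] at h2
        simp only [map_neg] at h2
        have h4 : (2 : ℝ)⁻¹ ^ (n + 1) * ‖p n z‖ ^ 2 ≤ 0 := neg_nonneg.1 h2
        have h5 : ‖p n z‖ ^ 2 ≤ 0 :=
          nonpos_of_mul_nonpos_right h4 (by positivity)
        have h6 : ‖p n z‖ = 0 := by
          have := le_antisymm h5 (by positivity)
          simpa using this
        exact norm_eq_zero.1 h6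
      rw [mul_sub, mul_one, sub_eq_zero] at hz
      exact hz.symm
    have h1 := Complex.hasSum_re
      (hσ.1.hasSum (fun n => real_smul_mem N ((2 : ℝ)⁻¹ ^ (n + 1)) (hp n).1) hcN hs)
    have h2 := Complex.hasSum_re ((innerSL ℂ ξ ∘L ContinuousLinearMap.apply ℂ H ξ).hasSum hs)
    have hcmp := hasSum_le (fun n => ?_) h1 h2
    · rw [hσ.1.map_real_smul ha] at hcmp
      simp only [ContinuousLinearMap.comp_apply, ContinuousLinearMap.apply_apply,
        innerSL_apply_apply, smul_apply] at hcmp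
      rw [← Complex.coe_smul, inner_smul_right, Complex.re_ofReal_mul,
        Complex.re_ofReal_mul] at hcmp
      exact le_of_mul_le_mul_left hcmp hc
    · rw [hσ.1.map_real_smul (hp n).1]
      simp only [ContinuousLinearMap.comp_apply, ContinuousLinearMap.apply_apply,
        innerSL_apply_apply, smul_apply]
      rw [← Complex.coe_smul, inner_smul_right, Complex.re_ofReal_mul, Complex.re_ofReal_mul,
        (hp n).2.inner_apply_self, Complex.ofReal_re]
      gcongr
      by_cases h0 : p n = 0
      · rw [h0]
        have := hσ.1.map_real_smul (zero_mem N) 0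
        simp only [smul_zero, Complex.ofReal_zero, zero_mul] at this
        simp [this]
      · exact (not_le.1 (hmax _ (hp n).1 (hp n).2 h0 (hpe n))).le
  intro x hx
  have hxe : x * (P - Q) ∈ N := mul_mem hx heN
  have h := hpos (star (x * (P - Q)) * (x * (P - Q))) (mul_mem (star_mem hxe) hxe)
    (star_mul_self_nonneg _) (by rw [mul_assoc, mul_assoc x, he.mul_self])
  refine h.trans_eq ?_
  rw [mul_apply_eq_comp, ContinuousLinearMap.star_eq_adjoint,
    ContinuousLinearMap.adjoint_inner_right, inner_self_eq_norm_sq_to_K]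
  norm_cast

/-- Complete additivity on projections passes from a state to its conjugates. -/
lemma IsNormalStateOn.tendsto_conjugate
    (hσ : IsNormalStateOn (N : Set (H →L[ℂ] H)) σ) {b : H →L[ℂ] H} (hb : b ∈ N)
    {s : Set (H →L[ℂ] H)} (hsN : s ⊆ (N : Set (H →L[ℂ] H))) (hs : OrthFamily s)
    {P : H →L[ℂ] H} (hPN : P ∈ N) (hP : IsSOTSum s P) :
    Filter.Tendsto (fun F : Finset s => σ (star b * (P - ∑ p ∈ F, (p : H →L[ℂ] H)) * b))
      Filter.atTop (nhds 0) := by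
  obtain ⟨C, hC⟩ := hσ.1.norm_le
  obtain ⟨M, hMN, hMo, hMR, Q, hQN, hQ, hQ1, hmax⟩ :=
    exists_maximal_orthFamily N (IsVectorDominated N σ) (P := 1)
      ⟨.one _, IsIdempotentElem.one⟩
  have hQe : Q = 1 := by
    by_contra hne
    obtain ⟨e, heN, he, he0, heQ, heR⟩ := hσ.exists_isVectorDominated
      (sub_mem (one_mem N) hQN) (hQ.isProjOp hMo).one_sub (sub_ne_zero.2 (Ne.symm hne))
    exact hmax e heN he he0 heQ heR
  subst hQe
  choose ξ hξ using fun p : M => hMR p p.2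
  set q : Finset s → H →L[ℂ] H := fun F => P - ∑ p ∈ F, (p : H →L[ℂ] H) with hq
  have hqp : ∀ F, IsProjOp (q F) := fun F => by
    refine (hs.isProjOp_sum F).sub (hP.isProjOp hs) ?_
    rw [Finset.sum_mul]
    exact Finset.sum_congr rfl fun p _ => hP.mul_eq hs p.2
  have hqN : ∀ F, q F ∈ N := fun F => sub_mem hPN (sum_mem fun p _ => hsN p.2)
  set y : Finset s → H →L[ℂ] H := fun F => star b * q F * b with hy
  have hyN : ∀ F, y F ∈ N := fun F => mul_mem (mul_mem (star_mem hb) (hqN F)) hb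
  have hyn : ∀ F, ‖y F‖ ≤ ‖b‖ * 1 * ‖b‖ := fun F => by
    refine (norm_mul_le _ _).trans ?_
    gcongr
    refine (norm_mul_le _ _).trans ?_
    rw [norm_star]
    gcongr
    exact ContinuousLinearMap.opNorm_le_bound _ zero_le_one fun x => by
      simpa using (hqp F).norm_apply_le x
  have hyt : ∀ x, Filter.Tendsto (fun F => ‖y F x‖) Filter.atTop (nhds 0) := by
    intro x
    have h1 : Filter.Tendsto (fun F => q F (b x)) Filter.atTop (nhds 0) := by
      have := (tendsto_const_nhds (x := P (b x))).sub (hP (b x))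
      rw [sub_self] at this
      refine this.congr fun F => ?_
      simp [hq]
    have h2 := ((star b).continuous.tendsto 0).comp h1
    rw [map_zero] at h2
    simpa using! h2.norm
  have hye : ∀ (e : M) (F), ‖σ (y F * e)‖ ≤ ‖y F (ξ e)‖ := by
    intro e F
    have h1 := hσ.1.cauchy_schwarz (one_mem N) (mul_mem (hyN F) (hMN e.2))
    rw [star_one, one_mul, one_mul, hσ.1.2.1, Complex.one_re, one_mul] at h1
    exact le_of_sq_le_sq (h1.trans (hξ e _ (hyN F))) (norm_nonneg _)
  set K := |C| * (‖b‖ * 1 * ‖b‖) ^ 2 + 1 with hK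
  have hK0 : 0 < K := by positivity
  rw [Metric.tendsto_nhds]
  intro ε hε
  have hsum := Complex.hasSum_re (hσ.2 M hMN hMo 1 (one_mem N) hQ)
  obtain ⟨G, hG⟩ : ∃ G : Finset M, K * (σ (1 - ∑ e ∈ G, (e : H →L[ℂ] H))).re < (ε / 2) ^ 2 := by
    have h := (((tendsto_const_nhds (x := (σ 1).re)).sub hsum).const_mul K)
    rw [sub_self, mul_zero] at h
    obtain ⟨G, hG⟩ := (h.eventually_lt_const (by positivity : 0 < (ε / 2) ^ 2)).exists
    refine ⟨G, ?_⟩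
    rw [hσ.1.map_sub (one_mem N) (sum_mem fun p _ => hMN p.2),
      hσ.1.map_sum _ _ fun p _ => hMN p.2]
    simpa using hG
  set f : H →L[ℂ] H := ∑ e ∈ G, (e : H →L[ℂ] H) with hf
  have hfN : f ∈ N := sum_mem fun p _ => hMN p.2
  have hfp : IsProjOp (1 - f) := (hMo.isProjOp_sum G).one_sub
  have htail : ∀ F, ‖σ (y F * (1 - f))‖ < ε / 2 := by
    intro F
    have h1 := hσ.1.cauchy_schwarz (star_mem (hyN F)) (sub_mem (one_mem N) hfN)
    rw [star_star, hfp.star_eq, hfp.mul_self] at h1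
    have h2 : (σ (y F * star (y F))).re ≤ K := by
      calc _ ≤ ‖σ (y F * star (y F))‖ := Complex.re_le_norm _
        _ ≤ C * ‖y F * star (y F)‖ := hC _ (mul_mem (hyN F) (star_mem (hyN F)))
        _ ≤ |C| * (‖b‖ * 1 * ‖b‖) ^ 2 := by
          rw [CStarRing.norm_self_mul_star, ← sq]
          gcongr
          · exact le_abs_self C
          · exact hyn F
        _ ≤ K := by rw [hK]; linarith
    have h3 : 0 ≤ (σ (1 - f)).re :=
      (Complex.nonneg_iff.1 (hσ.1.nonneg (sub_mem (one_mem N) hfN) hfp.nonneg)).1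
    refine lt_of_pow_lt_pow_left₀ 2 (by positivity) (h1.trans_lt (lt_of_le_of_lt ?_ hG))
    gcongr
  have hmain : Filter.Tendsto (fun F => ∑ e ∈ G, ‖y F (ξ e)‖) Filter.atTop (nhds 0) := by
    simpa using tendsto_finsetSum G fun e _ => hyt (ξ e)
  filter_upwards [hmain.eventually_lt_const (half_pos hε)] with F hF
  rw [dist_zero_right]
  have hdec : y F = ∑ e ∈ G, y F * (e : H →L[ℂ] H) + y F * (1 - f) := by
    rw [← Finset.mul_sum, ← mul_add, ← hf, add_sub_cancel, mul_one]
  have hmemG : ∀ e ∈ G, y F * (e : H →L[ℂ] H) ∈ N := fun e _ => mul_mem (hyN F) (hMN e.2)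
  change ‖σ (y F)‖ < ε
  rw [hdec, hσ.1.1.1 _ (sum_mem hmemG) _ (mul_mem (hyN F) (sub_mem (one_mem N) hfN)),
    hσ.1.map_sum _ _ hmemG]
  calc _ ≤ ‖∑ e ∈ G, σ (y F * (e : H →L[ℂ] H))‖ + ‖σ (y F * (1 - f))‖ := norm_add_le _ _
    _ ≤ ∑ e ∈ G, ‖y F (ξ e)‖ + ‖σ (y F * (1 - f))‖ := by
      gcongr
      exact (norm_sum_le _ _).trans (Finset.sum_le_sum fun e _ => hye e F)
    _ < ε / 2 + ε / 2 := add_lt_add hF (htail F)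
    _ = ε := add_halves ε

end NormalStates

section Conjugation

variable {K : Type u} [NormedAddCommGroup K] [InnerProductSpace ℂ K]

variable (K) in
/-- Every complex Hilbert space carries a conjugation. -/
lemma exists_conjugation [CompleteSpace K] : ∃ J : K ≃ₗᵢ⋆[ℂ] K, (∀ x, J (J x) = x) ∧
    ∀ x y, (⟪J x, J y⟫ : ℂ) = ⟪y, x⟫ := by
  obtain ⟨w, b, -⟩ := exists_hilbertBasis ℂ K
  refine ⟨(b.repr.trans (starₗᵢ ℂ)).trans b.repr.symm, fun x => by simp, fun x y => ?_⟩
  simp only [LinearIsometryEquiv.trans_apply, LinearIsometryEquiv.inner_map_map]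
  rw [← b.repr.inner_map_map, lp.inner_eq_tsum, lp.inner_eq_tsum]
  exact tsum_congr fun i => by simp [mul_comm]

/-- The operator `J a J` for a conjugation `J`. -/
def conjugateBy (J : K ≃ₗᵢ⋆[ℂ] K) (a : K →L[ℂ] K) : K →L[ℂ] K :=
  ((J : K →L⋆[ℂ] K).comp a).comp (J : K →L⋆[ℂ] K)

@[simp] lemma conjugateBy_apply (J : K ≃ₗᵢ⋆[ℂ] K) (a : K →L[ℂ] K) (x : K) :
    conjugateBy J a x = J (a (J x)) := rfl

lemma star_conjugateBy [CompleteSpace K] {J : K ≃ₗᵢ⋆[ℂ] K} (hJ : ∀ x, J (J x) = x)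
    (hJi : ∀ x y, (⟪J x, J y⟫ : ℂ) = ⟪y, x⟫) (a : K →L[ℂ] K) :
    star (conjugateBy J a) = conjugateBy J (star a) := by
  rw [ContinuousLinearMap.star_eq_adjoint, eq_comm, ContinuousLinearMap.eq_adjoint_iff]
  intro x y
  rw [conjugateBy_apply, conjugateBy_apply]
  rw [← hJ y, hJi, ← hJ x, hJi, hJ, hJ, ContinuousLinearMap.star_eq_adjoint,
    ContinuousLinearMap.adjoint_inner_right]

end Conjugation

section Diagonal

variable {K L : Type u} [NormedAddCommGroup K] [InnerProductSpace ℂ K] [NormedAddCommGroup L]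
  [InnerProductSpace ℂ L]

/-- The direct sum of two operators, on the Hilbert sum of the underlying spaces. -/
def diagonal (a : K →L[ℂ] K) (b : L →L[ℂ] L) : WithLp 2 (K × L) →L[ℂ] WithLp 2 (K × L) :=
  ((WithLp.prodContinuousLinearEquiv 2 ℂ K L).symm : K × L →L[ℂ] WithLp 2 (K × L)) ∘L
    a.prodMap b ∘L (WithLp.prodContinuousLinearEquiv 2 ℂ K L : WithLp 2 (K × L) →L[ℂ] K × L)

lemma diagonal_apply (a : K →L[ℂ] K) (b : L →L[ℂ] L) (x : WithLp 2 (K × L)) :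
    diagonal a b x = WithLp.toLp 2 (a x.fst, b x.snd) := rfl

lemma diagonal_star [CompleteSpace K] [CompleteSpace L] (a : K →L[ℂ] K) (b : L →L[ℂ] L) :
    diagonal (star a) (star b) = star (diagonal a b) := by
  rw [ContinuousLinearMap.star_eq_adjoint (diagonal a b), ContinuousLinearMap.eq_adjoint_iff]
  intro x y
  simp [diagonal_apply, WithLp.prod_inner_apply, ContinuousLinearMap.star_eq_adjoint,
    ContinuousLinearMap.adjoint_inner_left]

/-- The direct sum of two representations. -/
def diagonalRep [CompleteSpace K] [CompleteSpace L] {A : Type*} [Semiring A] [Algebra ℂ A]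
    [Star A] (π : A →⋆ₐ[ℂ] (K →L[ℂ] K)) (π' : A →⋆ₐ[ℂ] (L →L[ℂ] L)) :
    A →⋆ₐ[ℂ] (WithLp 2 (K × L) →L[ℂ] WithLp 2 (K × L)) where
  toFun a := diagonal (π a) (π' a)
  map_one' := by rw [map_one, map_one]; rfl
  map_mul' a b := by rw [map_mul, map_mul]; rfl
  map_zero' := by rw [map_zero, map_zero]; rfl
  map_add' a b := by rw [map_add, map_add]; rfl
  commutes' c := by
    simp only [AlgHomClass.commutes]
    rfl
  map_star' a := by simp only [map_star, diagonal_star]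

lemma diagonalRep_apply [CompleteSpace K] [CompleteSpace L] {A : Type*} [Semiring A] [Algebra ℂ A]
    [Star A] (π : A →⋆ₐ[ℂ] (K →L[ℂ] K)) (π' : A →⋆ₐ[ℂ] (L →L[ℂ] L)) (a : A)
    (x : WithLp 2 (K × L)) :
    diagonalRep π π' a x = WithLp.toLp 2 (π a x.fst, π' a x.snd) := rfl

end Diagonal

section Dilation

variable {N : VonNeumannAlgebra H} {σ : (H →L[ℂ] H) → ℂ}

/-- The GNS representation of a normal state is normal. -/
lemma IsNormalStateOn.hasSum_gns (hσ : IsNormalStateOn (N : Set (H →L[ℂ] H)) σ)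
    {L : Type u} [NormedAddCommGroup L] [InnerProductSpace ℂ L] [CompleteSpace L] {v : L}
    {π : N.toStarSubalgebra →⋆ₐ[ℂ] (L →L[ℂ] L)}
    (h1 : ∀ a : N.toStarSubalgebra, σ a = ⟪v, π a v⟫) (h2 : ∀ a, ‖π a‖ ≤ ‖(a : H →L[ℂ] H)‖)
    (h3 : DenseRange fun a => π a v) {s : Set (H →L[ℂ] H)} (hsN : s ⊆ (N : Set (H →L[ℂ] H)))
    (hs : OrthFamily s) {P : H →L[ℂ] H} (hPN : P ∈ N) (hP : IsSOTSum s P) (x : L) :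
    HasSum (fun p : s => π ⟨p, hsN p.2⟩ x) (π ⟨P, hPN⟩ x) := by
  set q : Finset s → N.toStarSubalgebra := fun F => ⟨P, hPN⟩ - ∑ p ∈ F, ⟨p, hsN p.2⟩ with hq
  have hqe : ∀ F, ((q F : N.toStarSubalgebra) : H →L[ℂ] H) = P - ∑ p ∈ F, (p : H →L[ℂ] H) :=
    fun F => by simp [hq]
  have hqp : ∀ F, IsProjOp (q F : H →L[ℂ] H) := fun F => by
    rw [hqe]
    refine (hs.isProjOp_sum F).sub (hP.isProjOp hs) ?_
    rw [Finset.sum_mul]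
    exact Finset.sum_congr rfl fun p _ => hP.mul_eq hs p.2
  have hqn : ∀ F, ‖π (q F)‖ ≤ 1 := fun F => (h2 _).trans <|
    ContinuousLinearMap.opNorm_le_bound _ zero_le_one fun y => by
      simpa using (hqp F).norm_apply_le y
  have key : Filter.Tendsto (fun F => π (q F) x) Filter.atTop (nhds 0) := by
    rw [Metric.tendsto_nhds]
    intro ε hε
    obtain ⟨b, hb⟩ := h3.exists_dist_lt x (half_pos hε)
    have hbt := hσ.tendsto_conjugate b.2 hsN hs hPN hP
    have hn : ∀ F, ‖π (q F) (π b v)‖ ^ 2 =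
        ‖σ (star (b : H →L[ℂ] H) * (P - ∑ p ∈ F, (p : H →L[ℂ] H)) * b)‖ := by
      intro F
      have hqq : star (q F * b) * (q F * b) = star b * q F * b := by
        apply Subtype.ext
        have := (hqp F).mul_self
        simp only [MulMemClass.coe_mul, StarMemClass.coe_star, star_mul, (hqp F).star_eq]
        rw [mul_assoc, ← mul_assoc _ (q F : H →L[ℂ] H) (b : H →L[ℂ] H), this, mul_assoc]
      have h := h1 (star (q F * b) * (q F * b))
      rw [map_mul, map_star, mul_apply_eq_comp, ContinuousLinearMap.star_eq_adjoint,
        ContinuousLinearMap.adjoint_inner_right, inner_self_eq_norm_sq_to_K, hqq, map_mul] at h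
      rw [← hqe]
      change σ (star (b : H →L[ℂ] H) * q F * b) = _ at h
      rw [h]
      simp
    have hlt := hbt.norm.eventually_lt_const (u := (ε / 2) ^ 2) (by simpa using by positivity)
    filter_upwards [hlt] with F hF
    rw [← hn] at hF
    have hF' := lt_of_pow_lt_pow_left₀ 2 (by positivity) hF
    rw [dist_zero_right]
    calc ‖π (q F) x‖ = ‖π (q F) (x - π b v) + π (q F) (π b v)‖ := by rw [← map_add, sub_add_cancel]
      _ ≤ ‖π (q F) (x - π b v)‖ + ‖π (q F) (π b v)‖ := norm_add_le _ _
      _ < ε / 2 + ε / 2 := by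
        refine add_lt_add ?_ hF'
        refine ((π (q F)).le_of_opNorm_le (hqn F) _).trans_lt ?_
        rwa [one_mul, ← dist_eq_norm]
      _ = ε := add_halves ε
  have h := (tendsto_const_nhds (x := π ⟨P, hPN⟩ x)).sub key
  rw [sub_zero] at h
  refine h.congr fun F => ?_
  simp [hq]

/-- Every state is a vector state of a faithful representation, normal if the state is. -/
lemma IsStateOn.exists_faithful_dilation (hσ : IsStateOn (N : Set (H →L[ℂ] H)) σ) :
    ∃ (K : HilbertSpc.{u}) (v : K.carrier)
      (ρ : N.toStarSubalgebra →⋆ₐ[ℂ] (K.carrier →L[ℂ] K.carrier)),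
      Function.Injective ρ ∧ (∀ a : N.toStarSubalgebra, σ a = ⟪v, ρ a v⟫) ∧
      (IsNormalStateOn (N : Set (H →L[ℂ] H)) σ → ∀ s (hsN : s ⊆ (N : Set (H →L[ℂ] H))),
        OrthFamily s → ∀ P (hPN : P ∈ N), IsSOTSum s P →
          ∀ x, HasSum (fun p : s => ρ ⟨p, hsN p.2⟩ x) (ρ ⟨P, hPN⟩ x)) := by
  obtain ⟨L, v, π, h1, h2, h3⟩ := exists_gns N hσ
  refine ⟨⟨WithLp 2 (L.carrier × H)⟩, WithLp.toLp 2 (v, 0),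
    diagonalRep π N.toStarSubalgebra.subtype, ?_, ?_, ?_⟩
  · intro a b hab
    apply Subtype.ext
    ext x
    simpa [diagonalRep_apply] using congr(($hab (WithLp.toLp 2 (0, x))).snd)
  · intro a
    rw [h1, diagonalRep_apply, WithLp.prod_inner_apply]
    simp
  · intro hn s hsN hs P hPN hP x
    have e1 := hn.hasSum_gns h1 h2 h3 hsN hs hPN hP x.fst
    exact (WithLp.prodContinuousLinearEquiv 2 ℂ L.carrier H).symm.hasSum.2 (e1.prodMk (hP x.snd))

end Dilation

section AntiDilation

variable {N : VonNeumannAlgebra H} {σ : (H →L[ℂ] H) → ℂ}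
  {K : Type u} [NormedAddCommGroup K] [InnerProductSpace ℂ K] [CompleteSpace K]

/-- A faithful unital *-antirepresentation of `N`. -/
structure IsAntiRep (N : VonNeumannAlgebra H) (Φ : (H →L[ℂ] H) → (K →L[ℂ] K)) : Prop where
  map_add : ∀ a ∈ N, ∀ b ∈ N, Φ (a + b) = Φ a + Φ b
  map_smul : ∀ (c : ℂ), ∀ a ∈ N, Φ (c • a) = c • Φ a
  map_star : ∀ a ∈ N, Φ (star a) = star (Φ a)
  map_mul : ∀ a ∈ N, ∀ b ∈ N, Φ (a * b) = Φ b * Φ a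
  map_one : Φ 1 = 1
  injOn : Set.InjOn Φ (N : Set (H →L[ℂ] H))

namespace IsAntiRep

variable {Φ : (H →L[ℂ] H) → (K →L[ℂ] K)}

lemma map_sub (hΦ : IsAntiRep N Φ) {a b : H →L[ℂ] H} (ha : a ∈ N) (hb : b ∈ N) :
    Φ (a - b) = Φ a - Φ b := by
  have h := hΦ.map_add (a - b) (sub_mem ha hb) b hb
  rw [sub_add_cancel] at h
  rw [h, add_sub_cancel_right]

lemma isJordanStarHomOn (hΦ : IsAntiRep N Φ) : IsJordanStarHomOn (N : Set (H →L[ℂ] H)) Φ :=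
  ⟨hΦ.map_add, hΦ.map_smul, hΦ.map_star, fun a ha b hb => by
    rw [hΦ.map_add _ (mul_mem ha hb) _ (mul_mem hb ha), hΦ.map_mul a ha b hb,
      hΦ.map_mul b hb a ha, add_comm]⟩

lemma timeOrientedOn (hΦ : IsAntiRep N Φ) : TimeOrientedOn (N : Set (H →L[ℂ] H)) Φ := by
  intro a ha b hb
  rw [hΦ.map_sub (mul_mem ha hb) (mul_mem hb ha), hΦ.map_mul a ha b hb, hΦ.map_mul b hb a ha]

lemma isFinAddEmbedding (hΦ : IsAntiRep N Φ) {S : Set (H →L[ℂ] H)}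
    (hS : S ⊆ (N : Set (H →L[ℂ] H))) :
    IsFinAddEmbedding S Φ := by
  refine ⟨fun p hp hpp => ⟨?_, ?_⟩, hΦ.injOn.mono fun p hp => hS hp.1, ?_,
    fun p hp _ => ?_, fun p hp q hq _ _ _ => hΦ.map_add p (hS hp) q (hS hq)⟩
  · rw [IsSelfAdjoint, ← hΦ.map_star p (hS hp), hpp.star_eq]
  · rw [IsIdempotentElem, ← hΦ.map_mul p (hS hp) p (hS hp), hpp.mul_self]
  · simpa using hΦ.map_smul 0 0 (zero_mem N)
  · rw [hΦ.map_sub (one_mem N) (hS hp), hΦ.map_one]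

end IsAntiRep

/-- Every state is a vector state of a faithful antirepresentation, normal if the state is. -/
lemma IsStateOn.exists_isAntiRep (hσ : IsStateOn (N : Set (H →L[ℂ] H)) σ) :
    ∃ (K : HilbertSpc.{u}) (v : K.carrier) (Φ : (H →L[ℂ] H) → (K.carrier →L[ℂ] K.carrier)),
      IsAntiRep N Φ ∧ (∀ a ∈ N, σ a = ⟪v, Φ a v⟫) ∧
      (IsNormalStateOn (N : Set (H →L[ℂ] H)) σ → IsNormalMapOn (N : Set (H →L[ℂ] H)) Φ) := by
  classical
  obtain ⟨K, v, ρ, hinj, hv, hn⟩ := hσ.exists_faithful_dilation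
  obtain ⟨J, hJ, hJi⟩ := exists_conjugation K.carrier
  set Φ : (H →L[ℂ] H) → (K.carrier →L[ℂ] K.carrier) :=
    fun a => if h : a ∈ N then conjugateBy J (ρ (star ⟨a, h⟩)) else 0
  have hΦ : ∀ a (h : a ∈ N), Φ a = conjugateBy J (ρ (star ⟨a, h⟩)) := fun a h => dif_pos h
  refine ⟨K, J v, Φ, ⟨fun a ha b hb => ?_, fun c a ha => ?_, fun a ha => ?_, fun a ha b hb => ?_,
    ?_, fun a ha b hb hab => ?_⟩, fun a ha => ?_, fun hnσ s hsN hs P hPN hP x => ?_⟩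
  · rw [hΦ _ (add_mem ha hb), hΦ a ha, hΦ b hb]
    have e : (⟨a + b, add_mem ha hb⟩ : N.toStarSubalgebra) = ⟨a, ha⟩ + ⟨b, hb⟩ := rfl
    ext x
    simp only [e, star_add, map_add, conjugateBy_apply, add_apply]
  · rw [hΦ _ (smul_mem' N c ha), hΦ a ha]
    have e : (⟨c • a, smul_mem' N c ha⟩ : N.toStarSubalgebra) = c • ⟨a, ha⟩ := rfl
    ext x
    simp only [e, star_smul, map_smul, conjugateBy_apply, smul_apply]
    rw [J.map_smulₛₗ]
    simp
  · rw [hΦ _ (star_mem ha), hΦ a ha, star_conjugateBy hJ hJi, ← map_star]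
    rfl
  · rw [hΦ _ (mul_mem ha hb), hΦ a ha, hΦ b hb]
    have e : (⟨a * b, mul_mem ha hb⟩ : N.toStarSubalgebra) = ⟨a, ha⟩ * ⟨b, hb⟩ := rfl
    ext x
    simp only [e, star_mul, map_mul, conjugateBy_apply, mul_apply_eq_comp, hJ]
  · rw [hΦ 1 (one_mem N)]
    have e : (⟨1, one_mem N⟩ : N.toStarSubalgebra) = 1 := rfl
    ext x
    simp [e, hJ]
  · rw [hΦ a ha, hΦ b hb] at hab
    have h : ρ (star ⟨a, ha⟩) = ρ (star ⟨b, hb⟩) := by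
      ext x
      have := congr($hab (J x))
      simpa [hJ] using this
    exact congrArg Subtype.val (star_injective (hinj h))
  · rw [hΦ a ha, conjugateBy_apply, hJ, hJi, map_star, ContinuousLinearMap.star_eq_adjoint,
      ContinuousLinearMap.adjoint_inner_left]
    exact hv ⟨a, ha⟩
  · have h := (J : K.carrier →L⋆[ℂ] K.carrier).hasSum (hn hnσ s hsN hs P hPN hP (J x))
    have e : ∀ p (hpN : p ∈ N), IsProjOp p → Φ p x = J (ρ ⟨p, hpN⟩ (J x)) := by
      intro p hpN hp
      have : star (⟨p, hpN⟩ : N.toStarSubalgebra) = ⟨p, hpN⟩ := Subtype.ext hp.star_eq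
      rw [hΦ p hpN, this, conjugateBy_apply]
    rw [e P hPN (hP.isProjOp hs)]
    simp_rw [fun p : s => e p (hsN p.2) (hs.1 p p.2)]
    exact h

/-- A state restricts to a global section of the probabilistic presheaf. -/
lemma IsStateOn.isGlobalSection (hσ : IsStateOn (N : Set (H →L[ℂ] H)) σ) :
    IsGlobalSection N fun _ p => (σ p).re := by
  refine ⟨fun V hV => ⟨by simp [hσ.2.1], fun p hp hpp => ?_, fun p hp q hq _ _ _ => ?_⟩,
    fun _ _ _ _ _ _ _ _ => rfl⟩
  · have h1 := (Complex.nonneg_iff.1 (hσ.nonneg (hV.1 hp) hpp.nonneg)).1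
    have h2 := (Complex.nonneg_iff.1
      (hσ.nonneg (sub_mem (one_mem N) (hV.1 hp)) hpp.one_sub.nonneg)).1
    rw [hσ.map_sub (one_mem N) (hV.1 hp), hσ.2.1, Complex.sub_re, Complex.one_re] at h2
    exact ⟨h1, by linarith⟩
  · beta_reduce
    rw [hσ.1.1 p (hV.1 hp) q (hV.1 hq), Complex.add_re]

/-- The vector functional of a time-oriented Jordan *-homomorphism is positive. -/
lemma isStateOn_of_timeOrientedOn {Φ : (H →L[ℂ] H) → (K →L[ℂ] K)} {v : K}
    (hJ : IsJordanStarHomOn (N : Set (H →L[ℂ] H)) Φ)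
    (hT : TimeOrientedOn (N : Set (H →L[ℂ] H)) Φ) (h1 : (⟪v, Φ 1 v⟫ : ℂ) = 1) :
    IsStateOn (N : Set (H →L[ℂ] H)) fun a => ⟪v, Φ a v⟫ := by
  refine ⟨⟨fun a ha b hb => ?_, fun c a ha => ?_⟩, h1, fun a ha => ?_⟩
  · beta_reduce
    rw [hJ.1 a ha b hb, add_apply, inner_add_right]
  · beta_reduce
    rw [hJ.2.1 c a ha, smul_apply, inner_smul_right]
  · have ha' : star a ∈ N := star_mem ha
    have e1 := hJ.2.2.2 _ ha' a ha
    have e2 := hT _ ha' a ha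
    have e3 := hJ.1 (star a * a + a * star a) (add_mem (mul_mem ha' ha) (mul_mem ha ha'))
      (star a * a - a * star a) (sub_mem (mul_mem ha' ha) (mul_mem ha ha'))
    have e4 := hJ.2.1 2 (star a * a) (mul_mem ha' ha)
    have e5 : (2 : ℂ) • (star a * a) =
        (star a * a + a * star a) + (star a * a - a * star a) := by
      rw [two_smul]; abel
    rw [e5, e3, e1, e2, hJ.2.2.1 a ha] at e4
    have e6 : Φ (star a * a) = Φ a * star (Φ a) := by
      refine smul_right_injective _ (two_ne_zero (α := ℂ)) ?_
      simp only
      rw [← e4, two_smul]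
      abel
    simp only [e6, mul_apply_eq_comp]
    rw [← ContinuousLinearMap.adjoint_inner_left, ← ContinuousLinearMap.star_eq_adjoint,
      inner_self_eq_norm_sq_to_K]
    norm_cast
    positivity

/-- The state induced by a compatible family of dilations, and its uniqueness. -/
lemma isStateOn_of_dilation {μ : VonNeumannAlgebra H → (H →L[ℂ] H) → ℝ}
    (hμ : IsGlobalSection N μ) {v : K} {φ : VonNeumannAlgebra H → (H →L[ℂ] H) → (K →L[ℂ] K)}
    (hd : ∀ V, IsContext N V → ∀ p ∈ V, IsProjOp p → (μ V p : ℂ) = (⟪v, φ V p v⟫ : ℂ))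
    {Φ : (H →L[ℂ] H) → (K →L[ℂ] K)} (hJ : IsJordanStarHomOn (N : Set (H →L[ℂ] H)) Φ)
    (he : ∀ V, IsContext N V → ∀ p ∈ V, IsProjOp p → Φ p = φ V p)
    (hT : TimeOrientedOn (N : Set (H →L[ℂ] H)) Φ) :
    IsStateOn (N : Set (H →L[ℂ] H)) (fun a => ⟪v, Φ a v⟫) ∧
      (∀ V, IsContext N V → ∀ p ∈ V, IsProjOp p → (μ V p : ℂ) = ⟪v, Φ p v⟫) ∧
      ∀ σ' : (H →L[ℂ] H) → ℂ, IsStateOn (N : Set (H →L[ℂ] H)) σ' →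
        (∀ V, IsContext N V → ∀ p ∈ V, IsProjOp p → (μ V p : ℂ) = σ' p) →
        Set.EqOn σ' (fun a => ⟪v, Φ a v⟫) (N : Set (H →L[ℂ] H)) := by
  have hag : ∀ V, IsContext N V → ∀ p ∈ V, IsProjOp p → (μ V p : ℂ) = ⟪v, Φ p v⟫ :=
    fun V hV p hp hpp => by rw [he V hV p hp hpp, hd V hV p hp hpp]
  have h1p : IsProjOp (1 : H →L[ℂ] H) := ⟨.one _, .one⟩
  have hst := isStateOn_of_timeOrientedOn (v := v) hJ hT <| by
    have hV := isContext_projectionContext (one_mem N) h1p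
    rw [← hag _ hV 1 (one_mem _) h1p, (hμ.1 _ hV).1, Complex.ofReal_one]
  refine ⟨hst, hag, fun σ' hσ' h => hσ'.eqOn_of_projections hst fun p hp hpp => ?_⟩
  have hV := isContext_projectionContext hp hpp
  rw [← h _ hV p (mem_projectionContext p) hpp, hag _ hV p (mem_projectionContext p) hpp]

end AntiDilation

/-- **Gleason in presheaf form (III).**  For a von Neumann algebra `N` with no type I₂
summand, equipped with its canonical dynamical correspondence: every (normal) state of
`N` gives rise, via its GNS dilation, to a *time-oriented* global section of the
(normal) dilated probabilistic presheaf of `N` over `V(N)` agreeing with it on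
projections, and conversely every time-oriented global section determines a unique
(normal) state of `N`. -/
theorem gleason_presheaf_form_time_oriented
    (N : VonNeumannAlgebra H) (hN : NoTypeI2Summand N) :
    ((∀ σ : (H →L[ℂ] H) → ℂ, IsStateOn (N : Set (H →L[ℂ] H)) σ →
        ∃ μ, IsTimeOrientedDilatedGS N μ ∧
          ∀ V, IsContext N V → ∀ p ∈ V, IsProjOp p → (μ V p : ℂ) = σ p) ∧
      (∀ μ, IsTimeOrientedDilatedGS N μ →
        ∃ σ : (H →L[ℂ] H) → ℂ, IsStateOn (N : Set (H →L[ℂ] H)) σ ∧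
          (∀ V, IsContext N V → ∀ p ∈ V, IsProjOp p → (μ V p : ℂ) = σ p) ∧
          ∀ σ' : (H →L[ℂ] H) → ℂ, IsStateOn (N : Set (H →L[ℂ] H)) σ' →
            (∀ V, IsContext N V → ∀ p ∈ V, IsProjOp p → (μ V p : ℂ) = σ' p) →
            Set.EqOn σ' σ (N : Set (H →L[ℂ] H)))) ∧
    ((∀ σ : (H →L[ℂ] H) → ℂ, IsNormalStateOn (N : Set (H →L[ℂ] H)) σ →
        ∃ μ, IsTimeOrientedNormalDilatedGS N μ ∧
          ∀ V, IsContext N V → ∀ p ∈ V, IsProjOp p → (μ V p : ℂ) = σ p) ∧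
      (∀ μ, IsTimeOrientedNormalDilatedGS N μ →
        ∃ σ : (H →L[ℂ] H) → ℂ, IsNormalStateOn (N : Set (H →L[ℂ] H)) σ ∧
          (∀ V, IsContext N V → ∀ p ∈ V, IsProjOp p → (μ V p : ℂ) = σ p) ∧
          ∀ σ' : (H →L[ℂ] H) → ℂ, IsNormalStateOn (N : Set (H →L[ℂ] H)) σ' →
            (∀ V, IsContext N V → ∀ p ∈ V, IsProjOp p → (μ V p : ℂ) = σ' p) →
            Set.EqOn σ' σ (N : Set (H →L[ℂ] H)))) := by
  refine ⟨⟨fun σ hσ => ?_, fun μ hμ => ?_⟩, ⟨fun σ hσ => ?_, fun μ hμ => ?_⟩⟩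
  · obtain ⟨K, v, Φ, hΦ, hv, -⟩ := hσ.exists_isAntiRep
    refine ⟨fun _ p => (σ p).re, ⟨hσ.isGlobalSection, K, v, fun _ => Φ,
      fun V hV => hΦ.isFinAddEmbedding hV.1, fun _ _ _ _ _ _ _ _ => rfl, fun V hV p hp hpp => ?_,
      Φ, hΦ.isJordanStarHomOn, fun _ _ _ _ _ => rfl, hΦ.timeOrientedOn⟩,
      fun V hV p hp hpp => hσ.proj_eq_re (hV.1 hp) hpp⟩
    rw [hσ.proj_eq_re (hV.1 hp) hpp, hv p (hV.1 hp)]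
  · obtain ⟨hμ, K, v, φ, -, -, hd, Φ, hJ, he, hT⟩ := hμ
    exact ⟨_, isStateOn_of_dilation hμ hd hJ he hT⟩
  · obtain ⟨K, v, Φ, hΦ, hv, hn⟩ := hσ.1.exists_isAntiRep
    have hn := hn hσ
    refine ⟨fun _ p => (σ p).re, ⟨⟨hσ.1.isGlobalSection, fun V hV s hs hso P hP hsP =>
      Complex.hasSum_re (hσ.2 s (hs.trans hV.1) hso P (hV.1 hP) hsP)⟩, K, v, fun _ => Φ,
      fun V hV => ⟨hΦ.isFinAddEmbedding hV.1, fun s hs hso P hP hsP =>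
        hn s (hs.trans hV.1) hso P (hV.1 hP) hsP⟩,
      fun _ _ _ _ _ _ _ _ => rfl, fun V hV p hp hpp => ?_,
      Φ, hΦ.isJordanStarHomOn, hn, fun _ _ _ _ _ => rfl, hΦ.timeOrientedOn⟩,
      fun V hV p hp hpp => hσ.1.proj_eq_re (hV.1 hp) hpp⟩
    rw [hσ.1.proj_eq_re (hV.1 hp) hpp, hv p (hV.1 hp)]
  · obtain ⟨hμ, K, v, φ, -, -, hd, Φ, hJ, hn, he, hT⟩ := hμ
    obtain ⟨hst, hag, huniq⟩ := isStateOn_of_dilation hμ.1 hd hJ he hT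
    refine ⟨_, ⟨hst, fun s hs hso P hP hsP => ?_⟩, hag, fun σ' hσ' => huniq σ' hσ'.1⟩
    exact (innerSL ℂ v).hasSum (hn s hs hso P hP hsP v)

end VNG
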